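/- Let T > 0 and let b, b̃, σ, σ̃ belong to the class M with σ(x) > 0 and σ̃(x) > 0 for all x. Let u be a classical solution of the parabolic equation associated with (b, σ, f) and ũ a classical solution of the parabolic equation associated with (b̃, σ̃, f), where f(x) = x². Suppose there exist ε ∈ (0, T) and a nonempty open set ω ⊂ ℝ with u = ũ on (0, ε) × ω. Let x₀ ∈ ω and x₂ > x₀ be such that b(x) = b̃(x) for all x ∈ [x₀, x₂] and σ² − σ̃² has a constant strict sign on (x₀, x₂] (i.e., σ(x)² − σ̃(x)² > 0 for all x ∈ (x₀, x₂] or σ(x)² − σ̃(x)² < 0 for all x ∈ (x₀, x₂]). Then a contradiction follows; that is, such x₀ and x₂ cannot exist. -/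

import Mathlib

open Set Filter

/-- A function `ψ : ℝ → ℝ` is piecewise analytic if there exist `δ > 0`, a strictly
increasing sequence `(κ j)_{j ∈ ℤ}` tending to `-∞` at `-∞` and `+∞` at `+∞` with
`κ (j+1) - κ j > δ`, and functions `φ j` analytic on `[κ j, κ (j+1)]`, such that
`ψ = φ j` on `[κ j, κ (j+1))`. -/
def PiecewiseAnalytic (ψ : ℝ → ℝ) : Prop :=
  ∃ (δ : ℝ) (κ : ℤ → ℝ) (φ : ℤ → ℝ → ℝ),
    0 < δ ∧ StrictMono κ ∧
    Tendsto κ atBot atBot ∧ Tendsto κ atTop atTop ∧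
    (∀ j : ℤ, δ < κ (j + 1) - κ j) ∧
    (∀ j : ℤ, AnalyticOn ℝ (φ j) (Icc (κ j) (κ (j + 1)))) ∧
    (∀ j : ℤ, ∀ x ∈ Ico (κ j) (κ (j + 1)), ψ x = φ j x)

/-- The class `M` of Lipschitz-continuous, piecewise analytic functions on `ℝ`. -/
def ClassM (ψ : ℝ → ℝ) : Prop :=
  (∃ K, LipschitzWith K ψ) ∧ PiecewiseAnalytic ψ

/-- `u : [0,T) × ℝ → ℝ` is a classical solution of
`∂ₜ u = (1/2) σ(x)² ∂ₓₓ u + b(x) ∂ₓ u`, `u(0, ·) = f`: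
`u`, `∂ₜ u`, `∂ₓ u`, `∂ₓₓ u` exist and are continuous on `[0,T) × ℝ`, the PDE holds
there, and the initial condition holds. -/
def IsClassicalSolution (T : ℝ) (b σ f : ℝ → ℝ) (u : ℝ → ℝ → ℝ) : Prop :=
  ContinuousOn (fun p : ℝ × ℝ => u p.1 p.2) (Ico 0 T ×ˢ univ) ∧
  (∀ t ∈ Ico 0 T, ∀ x : ℝ, DifferentiableAt ℝ (fun s => u s x) t) ∧
  (∀ t ∈ Ico 0 T, ∀ x : ℝ, DifferentiableAt ℝ (fun y => u t y) x) ∧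
  (∀ t ∈ Ico 0 T, ∀ x : ℝ, DifferentiableAt ℝ (deriv (fun y => u t y)) x) ∧
  ContinuousOn (fun p : ℝ × ℝ => deriv (fun s => u s p.2) p.1) (Ico 0 T ×ˢ univ) ∧
  ContinuousOn (fun p : ℝ × ℝ => deriv (fun y => u p.1 y) p.2) (Ico 0 T ×ˢ univ) ∧
  ContinuousOn (fun p : ℝ × ℝ => deriv (deriv (fun y => u p.1 y)) p.2) (Ico 0 T ×ˢ univ) ∧
  (∀ t ∈ Ico 0 T, ∀ x : ℝ,
    deriv (fun s => u s x) t =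
      (1 / 2) * (σ x) ^ 2 * deriv (deriv (fun y => u t y)) x
        + b x * deriv (fun y => u t y) x) ∧
  (∀ x : ℝ, u 0 x = f x)

lemma second_deriv_nonneg_of_min (g : ℝ → ℝ) (x : ℝ) (hg : ContinuousAt g x)
    (hmin : IsLocalMin g x) : 0 ≤ deriv (deriv g) x := by
  by_contra hneg
  push Not at hneg
  have h1 : deriv g x = 0 := hmin.deriv_eq_zero
  have hmax : IsLocalMax g x := isLocalMax_of_deriv_deriv_neg hneg h1 hg
  have hconst : g =ᶠ[nhds x] fun _ => g x := by
    filter_upwards [hmin, hmax] with y h2 h3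
    exact le_antisymm h3 h2
  have h4 := hconst.deriv.deriv.eq_of_nhds
  simp at h4
  linarith

lemma deriv_nonpos_of_left_min (g : ℝ → ℝ) (t a : ℝ) (hat : a < t) (hg : DifferentiableAt ℝ g t)
    (hmin : ∀ s ∈ Icc a t, g t ≤ g s) : deriv g t ≤ 0 := by
  by_contra hpos
  push Not at hpos
  have h := hg.hasDerivAt.hasDerivWithinAt (s := Iio t)
  rw [hasDerivWithinAt_iff_tendsto_slope' (by simp)] at h
  have h1 : ∀ᶠ s in nhdsWithin t (Iio t), 0 < slope g t s := h.eventually (lt_mem_nhds hpos)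
  have h2 : ∀ᶠ s in nhdsWithin t (Iio t), s ∈ Ioo a t := Ioo_mem_nhdsLT hat
  obtain ⟨s, hs1, hs2⟩ := (h1.and h2).exists
  rw [slope_def_field] at hs1
  have h3 := hmin s ⟨hs2.1.le, hs2.2.le⟩
  have : (g s - g t) / (s - t) ≤ 0 :=
    div_nonpos_of_nonneg_of_nonpos (by linarith) (by linarith [hs2.2])
  linarith

lemma pos_case
    (T : ℝ) (b bt sigma sigmat : ℝ → ℝ)
    (hb : Continuous b) (hs : Continuous sigma)
    (hspos : ∀ x, 0 < sigma x)
    (u ut : ℝ → ℝ → ℝ)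
    (hu : IsClassicalSolution T b sigma (fun x => x ^ 2) u)
    (hut : IsClassicalSolution T bt sigmat (fun x => x ^ 2) ut)
    (ε : ℝ) (hε : ε ∈ Ioo 0 T)
    (ω : Set ℝ) (hω : IsOpen ω)
    (hobs : ∀ t ∈ Ioo 0 ε, ∀ x ∈ ω, u t x = ut t x)
    (x₀ x₂ : ℝ) (hx₀ : x₀ ∈ ω) (hx₂ : x₀ < x₂)
    (hbeq : ∀ x ∈ Icc x₀ x₂, b x = bt x)
    (hσsign : ∀ x ∈ Ioc x₀ x₂, 0 < (sigma x) ^ 2 - (sigmat x) ^ 2) :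
    False := by
  obtain ⟨hε0, hεT⟩ := hε
  obtain ⟨uc, ut1, ux1, ux2, -, -, -, updE, u0⟩ := hu
  obtain ⟨vc, vt1, vx1, vx2, -, -, vxxc, vpdE, v0⟩ := hut
  have hT : 0 < T := hε0.trans hεT
  have h0T : (0 : ℝ) ∈ Ico 0 T := ⟨le_rfl, hT⟩
  -- second derivative of the initial datum
  have hd1 : deriv (fun y : ℝ => y ^ 2) = fun y => 2 * y := by
    ext y; simp
  have hd2 : ∀ x : ℝ, deriv (deriv (fun y : ℝ => y ^ 2)) x = 2 := by
    intro x; rw [hd1]; simp [deriv_const_mul_field]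
  have hu0 : (fun y => u 0 y) = fun y => y ^ 2 := funext u0
  have hv0 : (fun y => ut 0 y) = fun y => y ^ 2 := funext v0
  -- positivity of second derivative for small times
  obtain ⟨τ, hτ0, hτε, hτ⟩ : ∃ τ > 0, τ < ε ∧ ∀ t ∈ Icc 0 τ, ∀ x ∈ Icc x₀ x₂,
      0 ≤ deriv (deriv (fun y => ut t y)) x := by
    have hK : IsCompact (Icc (0 : ℝ) ε ×ˢ Icc x₀ x₂) := isCompact_Icc.prod isCompact_Icc
    have huc := hK.uniformContinuousOn_of_continuous (vxxc.mono (prod_mono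
      (fun t ht => ⟨ht.1, ht.2.trans_lt hεT⟩) (subset_univ _)))
    rw [Metric.uniformContinuousOn_iff] at huc
    obtain ⟨d, hd, H⟩ := huc 1 one_pos
    refine ⟨min d ε / 2, by positivity, ?_, ?_⟩
    · linarith [min_le_right d ε]
    · intro t ht x hx
      have hm1 := min_le_left d ε
      have hm2 := min_le_right d ε
      have hm3 : 0 < min d ε := lt_min hd hε0
      have := H (0, x) ⟨⟨le_rfl, hε0.le⟩, hx⟩ (t, x) ⟨⟨ht.1, by linarith [ht.2]⟩, hx⟩ (by
        rw [Prod.dist_eq, dist_self, Real.dist_eq]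
        rw [max_lt_iff]
        refine ⟨?_, hd⟩
        rw [abs_lt]; constructor <;> linarith [ht.1, ht.2])
      rw [Real.dist_eq] at this
      simp only [hv0] at this
      rw [hd2, abs_lt] at this
      linarith [this.2]
  -- growth at the right end point
  obtain ⟨c, hc, ρ, hρ, hgrow⟩ : ∃ c > 0, ∃ ρ > 0, ∀ t ∈ Ioo 0 ρ,
      c * t ≤ u t x₂ - ut t x₂ := by
    have hx2m : x₂ ∈ Icc x₀ x₂ := ⟨hx₂.le, le_rfl⟩
    set q := (sigma x₂) ^ 2 - (sigmat x₂) ^ 2 with hq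
    have hqpos : 0 < q := hσsign x₂ ⟨hx₂, le_rfl⟩
    have hD : HasDerivAt (fun s => u s x₂ - ut s x₂) q 0 := by
      have h := (ut1 0 h0T x₂).hasDerivAt.sub (vt1 0 h0T x₂).hasDerivAt
      rw [updE 0 h0T, vpdE 0 h0T, hu0, hv0, hd2, hbeq x₂ hx2m] at h
      refine h.congr_deriv ?_
      rw [hq]; ring
    have h := hD.hasDerivWithinAt (s := Ioi 0)
    rw [hasDerivWithinAt_iff_tendsto_slope' (by simp)] at h
    have h1 := h.eventually (lt_mem_nhds (show q / 2 < q by linarith))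
    obtain ⟨ρ, hρ, H⟩ := (mem_nhdsGT_iff_exists_Ioo_subset).1 h1
    refine ⟨q / 2, by linarith, ρ, hρ, fun t ht => ?_⟩
    have h2 := H ht
    simp only [mem_ofPred_eq, slope_def_field, u0, v0] at h2
    rw [lt_div_iff₀ (by linarith [ht.1])] at h2
    linarith
  -- the final time
  obtain ⟨s, hs0, hsτ, hsρ⟩ : ∃ s > 0, s < τ ∧ s < ρ := by
    have : 0 < min τ ρ := lt_min hτ0 hρ
    exact ⟨min τ ρ / 2, by linarith, by linarith [min_le_left τ ρ], by linarith [min_le_right τ ρ]⟩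
  set L := x₂ - x₀ with hL
  have hLpos : 0 < L := by linarith
  -- bounds on the coefficients
  obtain ⟨m, hm, hmle⟩ : ∃ m > 0, ∀ x ∈ Icc x₀ x₂, m ≤ (sigma x) ^ 2 := by
    obtain ⟨z, -, hz⟩ := isCompact_Icc.exists_isMinOn (nonempty_Icc.2 hx₂.le)
      ((hs.pow 2).continuousOn (s := Icc x₀ x₂))
    exact ⟨sigma z ^ 2, pow_pos (hspos z) 2, fun x hx => hz hx⟩
  obtain ⟨B, hB⟩ : ∃ B, ∀ x ∈ Icc x₀ x₂, B ≤ b x := by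
    obtain ⟨z, -, hz⟩ := isCompact_Icc.exists_isMinOn (nonempty_Icc.2 hx₂.le)
      (hb.continuousOn (s := Icc x₀ x₂))
    exact ⟨b z, fun x hx => hz hx⟩
  obtain ⟨lam, hlam, hlam2⟩ : ∃ lam > 0, 2 * L / s - B < lam * (m / 2) := by
    refine ⟨(|2 * L / s - B| + 1) / (m / 2), by positivity, ?_⟩
    rw [div_mul_cancel₀ _ (by positivity)]
    linarith [le_abs_self (2 * L / s - B)]
  set mu := 2 * lam * L / s with hmu
  have hmus : mu * s = 2 * lam * L := by rw [hmu]; field_simp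
  have hmupos : 0 < mu := by positivity
  have hop : ∀ x ∈ Icc x₀ x₂, mu - 1 / 2 * sigma x ^ 2 * lam ^ 2 - b x * lam < 0 := by
    intro x hx
    have h1 := hmle x hx
    have h2 := hB x hx
    have h3 : mu = lam * (2 * L / s) := by rw [hmu]; ring
    have h4 : 2 * L / s - 1 / 2 * sigma x ^ 2 * lam - b x < 0 := by nlinarith
    have h5 := mul_neg_of_pos_of_neg hlam h4
    rw [h3]; linarith
  obtain ⟨del, hdel, hdel2⟩ : ∃ del > 0, del * Real.exp (lam * L) = c * (s / 2) := by
    refine ⟨c * (s / 2) / Real.exp (lam * L), by positivity, ?_⟩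
    field_simp
  -- the comparison function
  let v : ℝ → ℝ → ℝ := fun t x => del * (Real.exp (lam * (x - x₀) - mu * (s - t)) - 1)
  let z : ℝ → ℝ → ℝ := fun t x => u t x - ut t x - v t x
  have hsT : ∀ t ∈ Icc 0 s, t ∈ Ico 0 T := fun t ht => ⟨ht.1, by linarith [ht.2]⟩
  have hzc : ContinuousOn (fun p : ℝ × ℝ => z p.1 p.2) (Icc 0 s ×ˢ Icc x₀ x₂) := by
    refine ((uc.sub vc).mono (prod_mono hsT (subset_univ _))).sub ?_
    apply Continuous.continuousOn
    fun_prop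
  obtain ⟨⟨t, x⟩, ⟨ht, hx⟩, hmin⟩ := (isCompact_Icc.prod isCompact_Icc).exists_isMinOn
    (⟨(0, x₀), ⟨le_rfl, hs0.le⟩, ⟨le_rfl, hx₂.le⟩⟩ : (Icc 0 s ×ˢ Icc x₀ x₂).Nonempty) hzc
  simp only at ht hx
  have hmin' : ∀ t' ∈ Icc 0 s, ∀ x' ∈ Icc x₀ x₂, z t x ≤ z t' x' :=
    fun t' ht' x' hx' => hmin (show (t', x') ∈ Icc 0 s ×ˢ Icc x₀ x₂ from ⟨ht', hx'⟩)
  have hznn : 0 ≤ z t x := by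
    by_contra hneg
    push Not at hneg
    have hvneg : ∀ t x, lam * (x - x₀) ≤ mu * (s - t) → v t x ≤ 0 := by
      intro t x h
      have : Real.exp (lam * (x - x₀) - mu * (s - t)) ≤ 1 := Real.exp_le_one_iff.2 (by linarith)
      exact mul_nonpos_of_nonneg_of_nonpos hdel.le (by linarith)
    have ht0 : 0 < t := by
      rcases ht.1.lt_or_eq with h | h
      · exact h
      · exfalso
        have h1 : v t x ≤ 0 := by
          apply hvneg
          rw [← h, sub_zero, hmus]
          have := mul_le_mul_of_nonneg_left (show x - x₀ ≤ L by linarith [hx.2]) hlam.le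
          nlinarith
        have h2 : u t x - ut t x = 0 := by rw [← h, u0, v0]; ring
        have : z t x = u t x - ut t x - v t x := rfl
        linarith
    have hx0 : x₀ < x := by
      rcases hx.1.lt_or_eq with h | h
      · exact h
      · exfalso
        have h1 : v t x ≤ 0 := by
          apply hvneg
          rw [← h, sub_self, mul_zero]
          exact mul_nonneg hmupos.le (by linarith [ht.2])
        have h2 : u t x - ut t x = 0 := by
          rw [← h, hobs t ⟨ht0, by linarith [ht.2]⟩ x₀ hx₀]; ring
        have : z t x = u t x - ut t x - v t x := rfl
        linarith
    have hx2 : x < x₂ := by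
      rcases hx.2.lt_or_eq with h | h
      · exact h
      · exfalso
        have h2 := hgrow t ⟨ht0, by linarith [ht.2]⟩
        rw [← h] at h2
        have h3 : v t x ≤ c * t := by
          rcases le_total t (s / 2) with h4 | h4
          · refine (hvneg t x ?_).trans (by positivity)
            have : mu * (s / 2) ≤ mu * (s - t) := mul_le_mul_of_nonneg_left (by linarith) hmupos.le
            rw [h, ← hL]; linarith
          · have h5 : Real.exp (lam * (x - x₀) - mu * (s - t)) ≤ Real.exp (lam * L) := by
              apply Real.exp_le_exp.2
              have : 0 ≤ mu * (s - t) := mul_nonneg hmupos.le (by linarith [ht.2])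
              rw [h, ← hL]; linarith
            have h6 : v t x ≤ del * Real.exp (lam * L) :=
              mul_le_mul_of_nonneg_left (by linarith) hdel.le
            have h7 := mul_le_mul_of_nonneg_left h4 hc.le
            linarith
        have : z t x = u t x - ut t x - v t x := rfl
        linarith
    have htT := hsT t ht
    set E := del * Real.exp (lam * (x - x₀) - mu * (s - t)) with hE
    have hEpos : 0 < E := by positivity
    -- time derivative
    have hzt : HasDerivAt (fun r => z r x)
        (deriv (fun r => u r x) t - deriv (fun r => ut r x) t - E * mu) t := by
      refine ((ut1 t htT x).hasDerivAt.sub (vt1 t htT x).hasDerivAt).sub ?_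
      have h := ((((((hasDerivAt_id t).const_sub s).const_mul mu).const_sub
        (lam * (x - x₀))).exp).sub_const 1).const_mul del
      refine h.congr_deriv ?_
      simp only [hE, id]; ring
    -- space derivatives
    have hzx : ∀ y, HasDerivAt (fun y => z t y)
        (deriv (fun y => u t y) y - deriv (fun y => ut t y) y
          - lam * (del * Real.exp (lam * (y - x₀) - mu * (s - t)))) y := by
      intro y
      refine ((ux1 t htT y).hasDerivAt.sub (vx1 t htT y).hasDerivAt).sub ?_
      have h := ((((((hasDerivAt_id y).sub_const x₀).const_mul lam).sub_const
        (mu * (s - t))).exp).sub_const 1).const_mul del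
      refine h.congr_deriv ?_
      simp only [id]; ring
    have hzx' : deriv (fun y => z t y) = fun y => (deriv (fun y => u t y) y
        - deriv (fun y => ut t y) y
          - lam * (del * Real.exp (lam * (y - x₀) - mu * (s - t)))) :=
      funext fun y => (hzx y).deriv
    have hzxx : HasDerivAt (deriv (fun y => z t y))
        (deriv (deriv (fun y => u t y)) x - deriv (deriv (fun y => ut t y)) x
          - lam ^ 2 * E) x := by
      rw [hzx']
      refine ((ux2 t htT x).hasDerivAt.sub (vx2 t htT x).hasDerivAt).sub ?_
      have h := ((((((hasDerivAt_id x).sub_const x₀).const_mul lam).sub_const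
        (mu * (s - t))).exp).const_mul del).const_mul lam
      refine h.congr_deriv ?_
      simp only [hE, id]; ring
    have hloc : IsLocalMin (fun y => z t y) x := by
      filter_upwards [Icc_mem_nhds hx0 hx2] with y hy
      exact hmin' t ht y hy
    have k1 := hloc.deriv_eq_zero
    have k2 := second_deriv_nonneg_of_min _ x (hzx x).continuousAt hloc
    have k3 := deriv_nonpos_of_left_min (fun r => z r x) t 0 ht0 hzt.differentiableAt
      (fun r hr => hmin' r ⟨hr.1, hr.2.trans ht.2⟩ x hx)
    rw [(hzx x).deriv, ← hE] at k1
    rw [hzxx.deriv] at k2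
    rw [hzt.deriv, updE t htT, vpdE t htT, ← hbeq x hx] at k3
    have k4 := hτ t ⟨ht.1, by linarith [ht.2]⟩ x hx
    have k5 := hσsign x ⟨hx0, hx.2⟩
    have k6 := mul_neg_of_pos_of_neg hEpos (hop x hx)
    have k7 := mul_nonneg k5.le k4
    have k8 := mul_nonneg (sq_nonneg (sigma x)) k2
    have k9 := congrArg (fun r => b x * r) k1
    simp only [mul_zero] at k9
    linarith
  -- contradiction at the final time
  obtain ⟨r, hr, hball⟩ := Metric.isOpen_iff.1 hω x₀ hx₀
  have hmr : 0 < min r L := lt_min hr hLpos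
  have hy1 : x₀ + min r L / 2 ∈ ω := by
    apply hball
    rw [Metric.mem_ball, Real.dist_eq, add_sub_cancel_left, abs_of_pos (by linarith)]
    linarith [min_le_left r L]
  have hy2 : x₀ + min r L / 2 ∈ Icc x₀ x₂ := ⟨by linarith, by linarith [min_le_right r L]⟩
  have h1 := hmin' s ⟨hs0.le, le_rfl⟩ _ hy2
  have h2 := hobs s ⟨hs0, by linarith⟩ _ hy1
  have h3 : 0 < v s (x₀ + min r L / 2) := by
    refine mul_pos hdel (sub_pos.2 (Real.one_lt_exp_iff.2 ?_))
    rw [sub_self, mul_zero, sub_zero, add_sub_cancel_left]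
    positivity
  have h4 : z s (x₀ + min r L / 2) = u s (x₀ + min r L / 2) - ut s (x₀ + min r L / 2)
    - v s (x₀ + min r L / 2) := rfl
  linarith

/-- Case 2 in the proof of Theorem 3 is ruled out: on a region where the drifts
coincide, the second-moment observation detects any constant-strict-sign discrepancy
of the squared diffusion coefficients. -/
theorem case2_ruled_out
    (T : ℝ) (hT : 0 < T)
    (b bt sigma sigmat : ℝ → ℝ)
    (hb : ClassM b) (hbt : ClassM bt)
    (hs : ClassM sigma) (hst : ClassM sigmat)
    (hspos : ∀ x, 0 < sigma x) (hstpos : ∀ x, 0 < sigmat x)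
    (u ut : ℝ → ℝ → ℝ)
    (hu : IsClassicalSolution T b sigma (fun x => x ^ 2) u)
    (hut : IsClassicalSolution T bt sigmat (fun x => x ^ 2) ut)
    (ε : ℝ) (hε : ε ∈ Ioo 0 T)
    (ω : Set ℝ) (hω : IsOpen ω) (hωne : ω.Nonempty)
    (hobs : ∀ t ∈ Ioo 0 ε, ∀ x ∈ ω, u t x = ut t x)
    (x₀ x₂ : ℝ) (hx₀ : x₀ ∈ ω) (hx₂ : x₀ < x₂)
    (hbeq : ∀ x ∈ Icc x₀ x₂, b x = bt x)
    (hσsign : (∀ x ∈ Ioc x₀ x₂, 0 < (sigma x) ^ 2 - (sigmat x) ^ 2) ∨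
      (∀ x ∈ Ioc x₀ x₂, (sigma x) ^ 2 - (sigmat x) ^ 2 < 0)) :
    False := by
  obtain ⟨⟨_, hb1⟩, -⟩ := hb
  obtain ⟨⟨_, hb2⟩, -⟩ := hbt
  obtain ⟨⟨_, hs1⟩, -⟩ := hs
  obtain ⟨⟨_, hs2⟩, -⟩ := hst
  rcases hσsign with h | h
  · exact pos_case T b bt sigma sigmat hb1.continuous hs1.continuous hspos u ut hu hut ε hε ω hω
      hobs x₀ x₂ hx₀ hx₂ hbeq h
  · exact pos_case T bt b sigmat sigma hb2.continuous hs2.continuous hstpos ut u hut hu ε hε ω hω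
      (fun t ht x hx => (hobs t ht x hx).symm) x₀ x₂ hx₀ hx₂ (fun x hx => (hbeq x hx).symm)
      (fun x hx => by linarith [h x hx])
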